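/- Let p be an odd prime. There exist m ∈ ℚ, λ ∈ ℕ, c ∈ ℚ, and n_0 ∈ ℕ such that for all n ≥ n_0, ord_p( ∏_{χ} ∑_{a=1}^{f_χ} (−1)^a χ(a) ) = m·p^n + λ·n + c, where the product runs over all odd primitive Dirichlet characters χ with values in ℂ_p whose conductor f_χ divides p^{n+1}. -/

import Mathlib

open Finset Polynomial
open DirichletCharacter (changeLevel changeLevel_eq_cast_of_dvd
  changeLevel_eq_cast_of_dvd')

/-- The alternating sum `∑_{a < N} (-1) ^ a χ(a)` attached to a Dirichlet character `χ` mod `N`. -/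
noncomputable def altSum {R : Type*} [CommRing R] {N : ℕ} (χ : DirichletCharacter R N) : R :=
  ∑ a ∈ range N, (-1 : R) ^ a * χ (a : ZMod N)

theorem sum_range_mul_of_periodic {R : Type*} [CommRing R] {f : ℕ → R} {d q : ℕ}
    (hf : Function.Periodic f d) (hd : Odd d) (hq : Odd q) :
    ∑ a ∈ range (q * d), (-1 : R) ^ a * f a = ∑ a ∈ range d, (-1 : R) ^ a * f a := by
  obtain ⟨k, rfl⟩ := hq
  induction k with
  | zero => simp
  | succ k ih =>
    have hodd : Odd ((2 * k + 1) * d) := (odd_two_mul_add_one k).mul hd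
    have h1 : ∀ x, f ((2 * k + 1) * d + x) = f x := fun x ↦ by
      rw [add_comm]; exact hf.nat_mul _ x
    have h2 : ∀ x, f ((2 * k + 1) * d + d + x) = f x := fun x ↦ by
      rw [add_right_comm, hf, h1]
    rw [show (2 * (k + 1) + 1) * d = (2 * k + 1) * d + d + d by ring, sum_range_add, sum_range_add,
      ih, add_assoc, ← sum_add_distrib, add_eq_left]
    refine sum_eq_zero fun x _ ↦ ?_
    rw [h1, h2, pow_add, pow_add _ _ x, pow_add, hodd.neg_one_pow, hd.neg_one_pow]
    ring

theorem altSum_changeLevel {R : Type*} [CommRing R] {d N : ℕ} [NeZero N]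
    (hdN : d ∣ N) (hN : Odd N) (hcop : ∀ a : ℕ, a.Coprime d → a.Coprime N)
    (χ : DirichletCharacter R d) : altSum (changeLevel hdN χ) = altSum χ := by
  obtain ⟨q, rfl⟩ := hdN
  have key : ∀ a : ℕ, changeLevel (Dvd.intro q rfl : d ∣ d * q) χ (a : ZMod (d * q)) =
      χ (a : ZMod d) := by
    intro a
    by_cases ha : a.Coprime d
    · have := changeLevel_eq_cast_of_dvd' χ (Dvd.intro q rfl : d ∣ d * q) (a := a)
        (Nat.isCoprime_iff_coprime.mpr (hcop a ha))
      simpa using this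
    · have h1 : ¬ a.Coprime (d * q) := fun h ↦ ha (Nat.Coprime.coprime_mul_right_right h)
      rw [MulChar.map_nonunit _ (by rwa [ZMod.isUnit_iff_coprime]),
        MulChar.map_nonunit _ (by rwa [ZMod.isUnit_iff_coprime])]
  rw [Nat.odd_mul] at hN
  unfold altSum
  simp_rw [key]
  rw [mul_comm d q, sum_range_mul_of_periodic (f := fun a ↦ χ (a : ZMod d)) _ hN.1 hN.2]
  intro x
  simp

theorem sum_Icc_eq_altSum {R : Type*} [CommRing R] {d : ℕ} (hd : 1 < d)
    (χ : DirichletCharacter R d) :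
    ∑ a ∈ Icc 1 d, (-1 : R) ^ a * χ (a : ZMod d) = altSum χ := by
  have h0 : χ 0 = 0 := χ.map_zero' hd.ne'
  rw [altSum, range_eq_Ico, sum_eq_sum_Ico_succ_bot (by lia), ← Ico_insert_right hd.le,
    sum_insert (by simp)]
  simp [h0]

theorem sum_conductor_eq_altSum {R : Type*} [CommRing R] {p n : ℕ} (hp : p.Prime) (hp2 : p ≠ 2)
    (χ : DirichletCharacter R (p ^ (n + 1))) (hχ : χ ≠ 1) :
    ∑ a ∈ Icc 1 χ.conductor, (-1 : R) ^ a * χ.primitiveCharacter ((a : ℕ) : ZMod χ.conductor) =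
      altSum χ := by
  have : NeZero (p ^ (n + 1)) := ⟨pow_ne_zero _ hp.ne_zero⟩
  obtain ⟨k, -, hk⟩ := (Nat.dvd_prime_pow hp).mp χ.conductor_dvd_level
  have h1 : χ.conductor ≠ 1 := fun h ↦ hχ (χ.eq_one_iff_conductor_eq_one.mpr h)
  have hk0 : k ≠ 0 := by rintro rfl; exact h1 (by simpa using hk)
  have h2 := χ.conductor_ne_zero
  rw [sum_Icc_eq_altSum (by lia)]
  conv_rhs => rw [← χ.changeLevel_primitiveCharacter]
  refine (altSum_changeLevel _ (hp.odd_of_ne_two hp2).pow (fun a ha ↦ ?_) _).symm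
  rw [hk, Nat.coprime_pow_right_iff (Nat.pos_of_ne_zero hk0)] at ha
  exact ha.pow_right _

/-- The alternating sum over the units of `ZMod N`, as a polynomial in a formal value of the
character at the generator `u`. -/
noncomputable def altPoly {N : ℕ} (u : (ZMod N)ˣ) : ℤ[X] :=
  ∑ k ∈ range (orderOf u), C ((-1) ^ ((u ^ k : (ZMod N)ˣ) : ZMod N).val) * X ^ k

theorem altSum_eq_eval₂_altPoly {R : Type*} [CommRing R] {N : ℕ} [NeZero N] {u : (ZMod N)ˣ}
    (hu : ∀ x, x ∈ Subgroup.zpowers u) (χ : DirichletCharacter R N) :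
    altSum χ = (altPoly u).eval₂ (Int.castRingHom R) (χ u) := by
  classical
  have h1 : altSum χ = ∑ x : ZMod N, (-1) ^ x.val * χ x := by
    refine sum_bij' (fun a _ ↦ (a : ZMod N)) (fun x _ ↦ x.val) (by simp)
      (fun x _ ↦ mem_range.mpr x.val_lt) (fun a ha ↦ ZMod.val_cast_of_lt (mem_range.mp ha))
      (fun x _ ↦ ZMod.natCast_zmod_val x) (fun a ha ↦ ?_)
    rw [ZMod.val_cast_of_lt (mem_range.mp ha)]
  have h2 : ∑ x : ZMod N, (-1) ^ x.val * χ x =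
      ∑ v : (ZMod N)ˣ, (-1) ^ (v : ZMod N).val * χ (v : ZMod N) := by
    symm
    refine sum_of_injOn (fun v : (ZMod N)ˣ ↦ (v : ZMod N)) (Units.val_injective.injOn) (by simp)
      (fun x _ hx ↦ ?_) (fun _ _ ↦ rfl)
    rw [MulChar.map_nonunit, mul_zero]
    rintro ⟨v, rfl⟩
    simp at hx
  rw [h1, h2, ← IsCyclic.image_range_orderOf hu, sum_image, altPoly]
  · simp [eval₂_finsetSum, eval₂_pow]
  · intro i hi j hj hij
    exact pow_injOn_Iio_orderOf (by simpa using hi) (by simpa using hj) hij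

theorem exists_dirichletCharacter_apply_eq {R : Type*} [CommRing R] {N : ℕ} {u : (ZMod N)ˣ}
    (hu : ∀ x, x ∈ Subgroup.zpowers u) {ξ : R} (hξ : ξ ^ orderOf u = 1) (h0 : orderOf u ≠ 0) :
    ∃ χ : DirichletCharacter R N, χ u = ξ := by
  have hord : orderOf (Units.ofPowEqOne ξ _ hξ h0) ∣ orderOf u :=
    orderOf_dvd_of_pow_eq_one (Units.pow_ofPowEqOne hξ h0)
  exact ⟨MulChar.ofUnitHom (monoidHomOfForallMemZpowers hu hord), by simp⟩

theorem dirichletCharacter_ext_generator {R : Type*} [CommRing R] {N : ℕ} {u : (ZMod N)ˣ}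
    (hu : ∀ x, x ∈ Subgroup.zpowers u) {χ ψ : DirichletCharacter R N} (h : χ u = ψ u) :
    χ = ψ := by
  apply MulChar.equivToUnitHom.injective
  rw [MonoidHom.eq_iff_eq_on_generator hu]
  ext
  simpa using h

theorem X_pow_sub_one_dvd_altPoly_sub {d N : ℕ} [NeZero N] [NeZero d] (hdN : d ∣ N) (hN : Odd N)
    (hcop : ∀ a : ℕ, a.Coprime d → a.Coprime N) {u : (ZMod N)ˣ} {v : (ZMod d)ˣ}
    (hu : ∀ x, x ∈ Subgroup.zpowers u) (hv : ∀ x, x ∈ Subgroup.zpowers v)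
    (huv : ZMod.unitsMap hdN u = v) :
    X ^ orderOf v - 1 ∣ altPoly u - altPoly v := by
  have hmk (P : ℤ[X]) : P.eval₂ (Int.castRingHom _) (AdjoinRoot.root (X ^ orderOf v - 1 : ℤ[X])) =
      AdjoinRoot.mk (X ^ orderOf v - 1) P := by
    rw [← AdjoinRoot.aeval_eq, aeval_def]
    congr 1
  have hξ : (AdjoinRoot.root (X ^ orderOf v - 1 : ℤ[X])) ^ orderOf v = 1 := by
    have := AdjoinRoot.mk_self (f := (X ^ orderOf v - 1 : ℤ[X]))
    rwa [map_sub, map_pow, AdjoinRoot.mk_X, map_one, sub_eq_zero] at this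
  obtain ⟨χ, hχ⟩ := exists_dirichletCharacter_apply_eq hv hξ (orderOf_pos v).ne'
  have h := altSum_changeLevel hdN hN hcop χ
  have h3 : changeLevel hdN χ u = χ v := by
    rw [changeLevel_eq_cast_of_dvd, ← ZMod.unitsMap_val hdN, huv]
  rw [altSum_eq_eval₂_altPoly hu, altSum_eq_eval₂_altPoly hv, h3, hχ, hmk, hmk,
    AdjoinRoot.mk_eq_mk] at h
  exact h

theorem PadicInt.exists_pow_eq_one_and_dvd (p : ℕ) [hp : Fact p.Prime] :
    ∃ η : ℤ_[p], η ^ (p - 1) = 1 ∧ ∀ k : ℕ, ‖η ^ k - 1‖ < 1 → p - 1 ∣ k := by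
  have hlt (x : ℤ_[p]) : ‖x‖ < 1 ↔ PadicInt.toZMod x = 0 := by
    rw [← RingHom.mem_ker, PadicInt.ker_toZMod, IsLocalRing.mem_maximalIdeal, PadicInt.mem_nonunits]
  obtain ⟨c, hc⟩ := IsCyclic.exists_generator (α := (ZMod p)ˣ)
  have hcord : orderOf c = p - 1 := by
    rw [orderOf_eq_card_of_forall_mem_zpowers hc, Nat.card_eq_fintype_card, ZMod.card_units]
  set a : ℤ_[p] := ((c : ZMod p).val : ℤ_[p]) with ha
  have hac : PadicInt.toZMod a = c := by simp [ha]
  have hanorm : ‖a‖ = 1 := by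
    refine le_antisymm (PadicInt.norm_le_one _) (not_lt.mp fun h ↦ ?_)
    rw [hlt, hac] at h
    exact c.ne_zero h
  have hpnorm : ‖((p - 1 : ℕ) : ℤ_[p])‖ = 1 := by
    refine le_antisymm (PadicInt.norm_le_one _) (not_lt.mp fun h ↦ ?_)
    rw [hlt, map_natCast, ZMod.natCast_eq_zero_iff] at h
    have := hp.out.two_le
    exact absurd (Nat.le_of_dvd (by lia) h) (by lia)
  have hF : ‖(X ^ (p - 1) - 1 : ℤ_[p][X]).aeval a‖ < 1 := by
    rw [hlt]
    simp only [map_sub, map_pow, aeval_X, map_one, hac]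
    rw [← hcord, ← Units.val_pow_eq_pow_val, pow_orderOf_eq_one, Units.val_one, sub_self]
  have hF' : ‖(derivative (X ^ (p - 1) - 1 : ℤ_[p][X])).aeval a‖ = 1 := by
    simp [hanorm, hpnorm, derivative_X_pow]
  obtain ⟨η, hη, hηa, -⟩ := hensels_lemma (F := (X ^ (p - 1) - 1 : ℤ_[p][X])) (a := a)
    (by rw [hF']; simpa using hF)
  rw [hF', hlt, map_sub, sub_eq_zero, hac] at hηa
  refine ⟨η, by simpa [sub_eq_zero] using hη, fun k hk ↦ ?_⟩
  rw [hlt, map_sub, map_pow, hηa, map_one, sub_eq_zero] at hk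
  rw [← hcord]
  exact orderOf_dvd_of_pow_eq_one (Units.ext (by simpa using hk))

/-- The reduction of a unit of `ℤ_p` modulo `p ^ (n + 1)`. -/
noncomputable def unitMod {p : ℕ} [Fact p.Prime] (g : ℤ_[p]ˣ) (n : ℕ) : (ZMod (p ^ (n + 1)))ˣ :=
  Units.map (PadicInt.toZModPow (n + 1)).toMonoidHom g

theorem unitsMap_unitMod {p : ℕ} [Fact p.Prime] (g : ℤ_[p]ˣ) (n : ℕ) :
    ZMod.unitsMap (pow_dvd_pow p n.succ.le_succ) (unitMod g (n + 1)) = unitMod g n := by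
  ext
  exact congr($(PadicInt.zmod_cast_comp_toZModPow (p := p) (n + 1) (n + 2) (by lia)) (g : ℤ_[p]))

theorem exists_unit_orderOf_unitMod {p : ℕ} [hp : Fact p.Prime] (hp2 : p ≠ 2) {η : ℤ_[p]}
    (hη : η ^ (p - 1) = 1) (hη' : ∀ k : ℕ, ‖η ^ k - 1‖ < 1 → p - 1 ∣ k) :
    ∃ g : ℤ_[p]ˣ, ∀ n, orderOf (unitMod g n) = p ^ n * (p - 1) := by
  have h2 := hp.out.two_le
  have h1 : IsUnit (1 + p : ℤ_[p]) := by
    rw [PadicInt.isUnit_iff, add_comm, IsUltrametricDist.norm_add_eq_max_of_norm_ne_norm,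
      norm_one, max_eq_right (PadicInt.norm_lt_one_iff_dvd (p : ℤ_[p]) |>.mpr dvd_rfl).le]
    simpa using (PadicInt.norm_lt_one_iff_dvd (p : ℤ_[p]) |>.mpr dvd_rfl).ne
  have h3 : IsUnit η := IsUnit.of_pow_eq_one hη (by lia)
  refine ⟨(h1.mul h3).unit, fun n ↦ ?_⟩
  rw [← orderOf_injective _ Units.coeHom_injective]
  have h4 : Units.coeHom _ (unitMod (h1.mul h3).unit n) =
      (1 + p : ZMod (p ^ (n + 1))) * PadicInt.toZModPow (n + 1) η := by
    simp [unitMod]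
  have h5 : orderOf (PadicInt.toZModPow (n + 1) η) = p - 1 := by
    refine Nat.dvd_antisymm (orderOf_dvd_of_pow_eq_one (by rw [← map_pow, hη, map_one])) (hη' _ ?_)
    have := pow_orderOf_eq_one (PadicInt.toZModPow (n + 1) η)
    rw [← map_pow, ← sub_eq_zero, ← map_one (PadicInt.toZModPow (n + 1)), ← map_sub,
      ← RingHom.mem_ker, PadicInt.ker_toZModPow, ← PadicInt.norm_le_pow_iff_mem_span_pow] at this
    refine this.trans_lt (zpow_lt_one_of_neg₀ (by exact_mod_cast hp.out.one_lt) (by lia))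
  have h6 := ZMod.orderOf_one_add_prime hp.out hp2 n
  rw [h4, (Commute.all _ _).orderOf_mul_eq_mul_orderOf_of_coprime, h5, h6]
  rw [h5, h6]
  exact ((Nat.coprime_self_sub_right (by lia)).mpr (Nat.coprime_one_right _)).pow_left n

theorem mem_zpowers_unitMod {p : ℕ} [hp : Fact p.Prime] {g : ℤ_[p]ˣ} {n : ℕ}
    (hg : orderOf (unitMod g n) = p ^ n * (p - 1)) (x : (ZMod (p ^ (n + 1)))ˣ) :
    x ∈ Subgroup.zpowers (unitMod g n) := by
  have : Subgroup.zpowers (unitMod g n) = ⊤ := by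
    rw [← Subgroup.card_eq_iff_eq_top, Nat.card_zpowers, hg, Nat.card_eq_fintype_card,
      ZMod.card_units_eq_totient, Nat.totient_prime_pow_succ hp.out]
  simp [this]

theorem PadicInt.exists_not_pow_dvd {p : ℕ} [hp : Fact p.Prime] {x : ℤ_[p]} (hx : x ≠ 0) :
    ∃ k : ℕ, ¬ (p : ℤ_[p]) ^ k ∣ x := by
  have := FiniteMultiplicity.of_not_isUnit PadicInt.prime_p.not_isUnit hx
  exact ⟨_, this.choose_spec⟩

theorem PadicInt.toZMod_eq_zero_iff {p : ℕ} [hp : Fact p.Prime] {x : ℤ_[p]} :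
    PadicInt.toZMod x = 0 ↔ (p : ℤ_[p]) ∣ x := by
  rw [← RingHom.mem_ker, PadicInt.ker_toZMod, PadicInt.maximalIdeal_eq_span_p,
    Ideal.mem_span_singleton]

/-- The Iwasawa invariants `μ` and `lam` of a sequence of polynomials over `ℤ_p` that is coherent
modulo `X ^ p ^ n - 1`. -/
theorem exists_iwasawa_invariants {p : ℕ} [hp : Fact p.Prime] {G : ℕ → ℤ_[p][X]}
    (hG : ∀ n, X ^ p ^ n - 1 ∣ G (n + 1) - G n) (hne : ∃ n, ¬ X ^ p ^ n - 1 ∣ G n) :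
    ∃ μ lam n₀ : ℕ, ∀ n, n₀ ≤ n → ∃ H : ℤ_[p][X], X ^ p ^ n - 1 ∣ G n - C ((p : ℤ_[p]) ^ μ) * H ∧
      (∀ i < lam, (p : ℤ_[p]) ∣ (taylor 1 H).coeff i) ∧ ¬ (p : ℤ_[p]) ∣ (taylor 1 H).coeff lam := by
  have hp0 (k : ℕ) : (p : ℤ_[p]) ^ k ≠ 0 := pow_ne_zero _ (by exact_mod_cast hp.out.ne_zero)
  have hmonic (n : ℕ) : (X ^ p ^ n - 1 : ℤ_[p][X]).Monic :=
    monic_X_pow_sub_C 1 (pow_ne_zero _ hp.out.ne_zero)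
  set R : ℕ → ℤ_[p][X] := fun n ↦ G n %ₘ (X ^ p ^ n - 1) with hR
  have hRstep (n : ℕ) : R n = R (n + 1) %ₘ (X ^ p ^ n - 1) := by
    refine modByMonic_eq_of_dvd_sub (hmonic n) ?_
    have h1 : (X ^ p ^ n - 1 : ℤ_[p][X]) ∣ X ^ p ^ (n + 1) - 1 := by
      rw [pow_succ, pow_mul]
      simpa using sub_dvd_pow_sub_pow (X ^ p ^ n : ℤ_[p][X]) 1 p
    have h2 := h1.trans (dvd_modByMonic_sub (G (n + 1)) (X ^ p ^ (n + 1) - 1))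
    rw [← dvd_neg]
    convert dvd_add (hG n) h2 using 1
    ring
  have hex : ∃ k n, ¬ C ((p : ℤ_[p]) ^ k) ∣ R n := by
    obtain ⟨n, hn⟩ := hne
    rw [← modByMonic_eq_zero_iff_dvd (hmonic n)] at hn
    obtain ⟨i, hi⟩ : ∃ i, (R n).coeff i ≠ 0 := by
      by_contra! h
      exact hn (Polynomial.ext (by simpa using h))
    obtain ⟨k, hk⟩ := PadicInt.exists_not_pow_dvd hi
    exact ⟨k, n, fun h ↦ hk ((C_dvd_iff_dvd_coeff _ _).mp h i)⟩
  classical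
  obtain ⟨μ, hμ⟩ : ∃ μ, Nat.find hex = μ + 1 := by
    refine Nat.exists_eq_succ_of_ne_zero fun h ↦ ?_
    obtain ⟨n, hn⟩ := Nat.find_spec hex
    rw [h] at hn
    simp at hn
  obtain ⟨n₁, hn₁⟩ := Nat.find_spec hex
  rw [hμ] at hn₁
  have hdvd (n : ℕ) : C ((p : ℤ_[p]) ^ μ) ∣ R n := by
    by_contra h
    exact Nat.find_min hex (m := μ) (by lia) ⟨n, h⟩
  choose H hH using hdvd
  have hC0 : (C ((p : ℤ_[p]) ^ μ)) ≠ 0 := C_ne_zero.mpr (hp0 μ)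
  have hHstep (n : ℕ) : H n = H (n + 1) %ₘ (X ^ p ^ n - 1) := by
    have h := hRstep n
    rw [hH, hH, ← smul_eq_C_mul, ← smul_eq_C_mul, smul_modByMonic] at h
    exact smul_right_injective _ (hp0 μ) h
  set h : ℕ → (ZMod p)[X] := fun n ↦ (H n).map PadicInt.toZMod with hh
  have hq (n : ℕ) : (X ^ p ^ n - 1 : ℤ_[p][X]).map PadicInt.toZMod = (X - C 1) ^ p ^ n := by
    rw [sub_pow_char_pow]
    simp
  have hstep (n : ℕ) : h n = h (n + 1) %ₘ (X - C 1) ^ p ^ n := by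
    rw [← hq, ← map_modByMonic _ (hmonic n), ← hHstep]
  have hdvd_iff (n k : ℕ) (hk : k ≤ p ^ n) : (X - C 1) ^ k ∣ h (n + 1) ↔ (X - C 1) ^ k ∣ h n := by
    rw [hstep n]
    have h1 := (pow_dvd_pow (X - C (1 : ZMod p)) hk).trans
      (dvd_modByMonic_sub (h (n + 1)) ((X - C 1) ^ p ^ n))
    exact (dvd_iff_dvd_of_dvd_sub h1).symm
  have hmon (n : ℕ) : ((X - C (1 : ZMod p)) ^ p ^ n).Monic := (monic_X_sub_C 1).pow _
  have hn₁' : ¬ (X - C 1) ^ p ^ n₁ ∣ h n₁ := by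
    intro h1
    have h2 : h n₁ = 0 := by
      rw [hstep n₁, modByMonic_eq_zero_iff_dvd (hmon _)]
      exact (hdvd_iff _ _ le_rfl).mpr h1
    apply hn₁
    rw [hH, pow_succ, C_mul]
    refine mul_dvd_mul_left _ ((C_dvd_iff_dvd_coeff _ _).mpr fun i ↦ ?_)
    rw [← PadicInt.toZMod_eq_zero_iff, ← coeff_map]
    exact congr(($h2).coeff i)
  have hexl : ∃ l, ¬ (X - C 1) ^ l ∣ h n₁ := ⟨_, hn₁'⟩
  obtain ⟨lam, hlam⟩ : ∃ l, Nat.find hexl = l + 1 := by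
    refine Nat.exists_eq_succ_of_ne_zero fun h ↦ ?_
    have := Nat.find_spec hexl
    rw [h] at this
    simp at this
  have hlam_le : lam + 1 ≤ p ^ n₁ := hlam ▸ Nat.find_min' _ hn₁'
  have hinv (n : ℕ) (hn : n₁ ≤ n) :
      (X - C 1) ^ lam ∣ h n ∧ ¬ (X - C 1) ^ (lam + 1) ∣ h n := by
    induction n, hn using Nat.le_induction with
    | base =>
      refine ⟨?_, ?_⟩
      · by_contra h1
        exact Nat.find_min hexl (m := lam) (by lia) h1
      · rw [← hlam]
        exact Nat.find_spec hexl
    | succ n hn ih =>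
      have : p ^ n₁ ≤ p ^ n := Nat.pow_le_pow_right hp.out.pos hn
      rwa [hdvd_iff n _ (by lia), hdvd_iff n _ (by lia)]
  refine ⟨μ, lam, n₁, fun n hn ↦ ⟨H n, ?_, ?_⟩⟩
  · rw [← hH, ← dvd_neg, neg_sub]
    exact dvd_modByMonic_sub _ _
  · have hco (k : ℕ) : (X - C 1) ^ k ∣ h n ↔
        ∀ i < k, (p : ℤ_[p]) ∣ (taylor 1 (H n)).coeff i := by
      rw [← map_dvd_iff (taylorEquiv (1 : ZMod p)), map_pow]
      have : taylorEquiv (1 : ZMod p) (X - C 1) = X := by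
        change taylor 1 (X - C 1) = X
        simp
      rw [this, X_pow_dvd_iff]
      refine forall₂_congr fun i _ ↦ ?_
      rw [← PadicInt.toZMod_eq_zero_iff, ← coeff_map, map_taylor, map_one]
      rfl
    have := hinv n hn
    rw [hco, hco] at this
    refine ⟨this.1, fun h1 ↦ this.2 fun i hi ↦ ?_⟩
    rcases Nat.lt_succ_iff_lt_or_eq.mp hi with hi | rfl
    exacts [this.1 i hi, h1]

theorem IsPrimitiveRoot.norm_sub_one_le {K : Type*} [NormedField K] [IsUltrametricDist K] {n : ℕ}
    [NeZero n] {ζ ξ : K} (hζ : IsPrimitiveRoot ζ n) (hξ : IsPrimitiveRoot ξ n) :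
    ‖ξ - 1‖ ≤ ‖ζ - 1‖ := by
  obtain ⟨i, -, rfl⟩ := hζ.eq_pow_of_pow_eq_one hξ.pow_eq_one
  rw [← mul_geom_sum, norm_mul]
  refine mul_le_of_le_one_right (norm_nonneg _) ?_
  refine IsUltrametricDist.norm_sum_le_of_forall_le_of_nonneg zero_le_one fun j _ ↦ ?_
  have h1 : ‖ζ‖ ^ n = 1 := by rw [← norm_pow, hζ.pow_eq_one, norm_one]
  rw [norm_pow, (pow_eq_one_iff_of_nonneg (norm_nonneg _) (NeZero.ne n)).mp h1, one_pow]

theorem IsPrimitiveRoot.norm_sub_one_pow_totient {K : Type*} [NormedField K] [IsUltrametricDist K]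
    {p k : ℕ} [hp : Fact p.Prime] {ζ : K} (hζ : IsPrimitiveRoot ζ (p ^ (k + 1))) :
    ‖ζ - 1‖ ^ (p ^ (k + 1)).totient = ‖(p : K)‖ := by
  have : NeZero (p ^ (k + 1)) := ⟨pow_ne_zero _ hp.out.ne_zero⟩
  have h := congr(‖eval 1 $(cyclotomic_eq_prod_X_sub_primitiveRoots hζ)‖)
  rw [eval_one_cyclotomic_prime_pow, eval_prod, norm_prod] at h
  rw [h, ← hζ.card_primitiveRoots, ← prod_const]
  refine prod_congr rfl fun ξ hξ ↦ ?_
  have hξ' := isPrimitiveRoot_of_mem_primitiveRoots hξ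
  rw [eval_sub, eval_X, eval_C, norm_sub_rev 1]
  exact le_antisymm (hξ'.norm_sub_one_le hζ) (hζ.norm_sub_one_le hξ')

theorem norm_eval₂_eq_pow {p : ℕ} [hp : Fact p.Prime] {K : Type*} [NormedField K]
    [IsUltrametricDist K] {f : ℤ_[p] →+* K} (hf : ∀ x, ‖f x‖ = ‖x‖) {H : ℤ_[p][X]} {lam : ℕ}
    (h1 : ∀ i < lam, (p : ℤ_[p]) ∣ (taylor 1 H).coeff i)
    (h2 : ¬ (p : ℤ_[p]) ∣ (taylor 1 H).coeff lam)
    {ζ : K} (hζ1 : ‖ζ - 1‖ < 1) (hζ : (p : ℝ)⁻¹ < ‖ζ - 1‖ ^ lam) :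
    ‖H.eval₂ f ζ‖ = ‖ζ - 1‖ ^ lam := by
  set t := ζ - 1 with ht
  have heval : H.eval₂ f ζ = ∑ i ∈ range ((taylor 1 H).natDegree + 1),
      f ((taylor 1 H).coeff i) * t ^ i := by
    rw [← eval₂_eq_sum_range, eval₂_eq_eval_map, eval₂_eq_eval_map, map_taylor, map_one,
      taylor_eval, ht, sub_add_cancel]
  have hpos : 0 < ‖t‖ ^ lam := (inv_pos.mpr (by exact_mod_cast hp.out.pos)).trans hζ
  have ht0 : 0 < ‖t‖ ∨ lam = 0 := by
    rcases (norm_nonneg t).eq_or_lt with h | h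
    · right
      by_contra h0
      rw [← h, zero_pow h0] at hpos
      exact hpos.false
    · exact .inl h
  have hmem : lam ∈ range ((taylor 1 H).natDegree + 1) := by
    rw [mem_range, Nat.lt_succ_iff]
    refine le_natDegree_of_ne_zero fun h ↦ h2 ?_
    rw [h]
    exact dvd_zero _
  have hmain : ‖f ((taylor 1 H).coeff lam) * t ^ lam‖ = ‖t‖ ^ lam := by
    rw [norm_mul, hf, norm_pow, (le_antisymm (PadicInt.norm_le_one _) (not_lt.mp _) : _ = (1 : ℝ)),
      one_mul]
    rwa [PadicInt.norm_lt_one_iff_dvd]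
  have hrest : ‖∑ i ∈ (range ((taylor 1 H).natDegree + 1)).erase lam,
      f ((taylor 1 H).coeff i) * t ^ i‖ < ‖t‖ ^ lam := by
    rcases ((range ((taylor 1 H).natDegree + 1)).erase lam).eq_empty_or_nonempty with h | h
    · rwa [h, sum_empty, norm_zero]
    obtain ⟨i, hi, hle⟩ := IsUltrametricDist.exists_norm_finsetSum_le_of_nonempty h
      (fun i ↦ f ((taylor 1 H).coeff i) * t ^ i)
    refine hle.trans_lt ?_
    rw [norm_mul, hf, norm_pow]
    rcases lt_or_gt_of_ne (ne_of_mem_erase hi) with hlt | hgt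
    · refine lt_of_le_of_lt ?_ hζ
      have := (PadicInt.norm_le_pow_iff_mem_span_pow ((taylor 1 H).coeff i) 1).mpr
        (by rw [pow_one]; exact Ideal.mem_span_singleton.mpr (h1 i hlt))
      refine (mul_le_of_le_one_right (norm_nonneg _) (pow_le_one₀ (norm_nonneg _) hζ1.le)).trans ?_
      simpa using this
    · refine (mul_le_of_le_one_left (by positivity) (PadicInt.norm_le_one _)).trans_lt ?_
      rcases ht0 with h | h
      · exact pow_lt_pow_right_of_lt_one₀ h hζ1 hgt
      · rw [h, pow_zero]
        exact pow_lt_one₀ (norm_nonneg _) hζ1 (by lia)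
  rw [heval, ← add_sum_erase _ _ hmem, IsUltrametricDist.norm_add_eq_max_of_norm_ne_norm, hmain,
    max_eq_left hrest.le]
  rw [hmain]
  exact hrest.ne'

theorem prod_primitiveRoots_norm_eval₂ {p : ℕ} [hp : Fact p.Prime] {K : Type*} [NormedField K]
    [IsUltrametricDist K] {f : ℤ_[p] →+* K} (hf : ∀ x, ‖f x‖ = ‖x‖) {H : ℤ_[p][X]} {μ lam k : ℕ}
    (hK : (primitiveRoots (p ^ (k + 1)) K).Nonempty)
    (h1 : ∀ i < lam, (p : ℤ_[p]) ∣ (taylor 1 H).coeff i)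
    (h2 : ¬ (p : ℤ_[p]) ∣ (taylor 1 H).coeff lam)
    (hlam : lam < (p ^ (k + 1)).totient) :
    ∏ ζ ∈ primitiveRoots (p ^ (k + 1)) K, ‖(C ((p : ℤ_[p]) ^ μ) * H).eval₂ f ζ‖ =
      ((p : ℝ)⁻¹) ^ (μ * (p ^ (k + 1)).totient + lam) := by
  obtain ⟨ξ, hξ⟩ := hK
  have hξ' := isPrimitiveRoot_of_mem_primitiveRoots hξ
  have hnp : ‖(p : K)‖ = (p : ℝ)⁻¹ := by
    rw [← map_natCast f, hf, PadicInt.norm_p]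
  have hpow := hξ'.norm_sub_one_pow_totient
  rw [hnp] at hpow
  have hp1 : (p : ℝ)⁻¹ < 1 := inv_lt_one_of_one_lt₀ (by exact_mod_cast hp.out.one_lt)
  have hp0 : 0 < (p : ℝ)⁻¹ := inv_pos.mpr (by exact_mod_cast hp.out.pos)
  have hlt : ‖ξ - 1‖ < 1 := by
    by_contra! h
    exact (one_le_pow₀ h).not_gt (hpow ▸ hp1)
  have hpos : 0 < ‖ξ - 1‖ := by
    refine (norm_nonneg _).lt_of_ne fun h ↦ ?_
    rw [← h, zero_pow (by lia)] at hpow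
    exact hp0.ne hpow
  have heq : ∀ ζ ∈ primitiveRoots (p ^ (k + 1)) K,
      ‖(C ((p : ℤ_[p]) ^ μ) * H).eval₂ f ζ‖ = (p : ℝ)⁻¹ ^ μ * ‖ξ - 1‖ ^ lam := by
    intro ζ hζ
    have hζ' := isPrimitiveRoot_of_mem_primitiveRoots hζ
    have : NeZero (p ^ (k + 1)) := ⟨pow_ne_zero _ hp.out.ne_zero⟩
    have h3 : ‖ζ - 1‖ = ‖ξ - 1‖ := le_antisymm (hξ'.norm_sub_one_le hζ') (hζ'.norm_sub_one_le hξ')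
    rw [eval₂_mul, eval₂_C, norm_mul, hf, norm_pow, PadicInt.norm_p,
      norm_eval₂_eq_pow hf h1 h2 (h3 ▸ hlt), h3]
    rw [h3, ← hpow]
    exact pow_lt_pow_right_of_lt_one₀ hpos hlt hlam
  rw [prod_congr rfl heq, prod_const, hξ'.card_primitiveRoots, mul_pow, ← pow_mul, ← pow_mul,
    mul_comm lam, pow_mul _ _ lam, hpow, ← pow_add]

theorem pow_half_orderOf_eq_neg_one {N : ℕ} (hN : 2 < N) {u : (ZMod N)ˣ}
    (hu : ∀ x, x ∈ Subgroup.zpowers u) {m : ℕ} (hm : orderOf u = 2 * m) : u ^ m = -1 := by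
  have : NeZero N := ⟨by lia⟩
  have : Fact (2 < N) := ⟨hN⟩
  obtain ⟨j, hj, hju⟩ := (IsOfFinOrder.mem_zpowers_iff_mem_range_orderOf
    (isOfFinOrder_of_finite u)).mp (hu (-1)) |> Finset.mem_image.mp
  rw [mem_range] at hj
  have h2 : orderOf u ∣ 2 * j := by
    apply orderOf_dvd_of_pow_eq_one
    rw [mul_comm, pow_mul, hju, neg_one_sq]
  have hj0 : j ≠ 0 := by
    rintro rfl
    rw [pow_zero, Units.ext_iff] at hju
    exact ZMod.neg_one_ne_one (by simpa using hju.symm)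
  obtain ⟨c, hc⟩ := h2
  have hc1 : c = 1 := by
    rcases c with _ | _ | c
    · lia
    · rfl
    · exfalso
      have : 2 * orderOf u ≤ orderOf u * (c + 1 + 1) := by nlinarith
      lia
  rw [← hju, show m = j by rw [hc1] at hc; lia]

theorem finprod_odd_eq_prod_nthRootsFinset {R : Type*} [CommRing R] [IsDomain R] [CharZero R]
    {p n m : ℕ} (hp : p.Prime) (hp2 : p ≠ 2) {u : (ZMod (p ^ (n + 1)))ˣ}
    (hu : ∀ x, x ∈ Subgroup.zpowers u) (hm : orderOf u = 2 * m) :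
    (∏ᶠ (χ : DirichletCharacter R (p ^ (n + 1))) (_ : χ.Odd), ∑ a ∈ Icc 1 χ.conductor,
      (-1 : R) ^ a * χ.primitiveCharacter ((a : ℕ) : ZMod χ.conductor)) =
      ∏ ξ ∈ nthRootsFinset m (-1 : R), (altPoly u).eval₂ (Int.castRingHom R) ξ := by
  have h3 : 2 < p ^ (n + 1) := calc
    2 < p := lt_of_le_of_ne hp.two_le hp2.symm
    _ ≤ p ^ (n + 1) := Nat.le_self_pow (by lia) p
  have : NeZero (p ^ (n + 1)) := ⟨by lia⟩
  have hum := pow_half_orderOf_eq_neg_one h3 hu hm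
  have hm0 : 0 < m := by have := orderOf_pos u; lia
  have hodd (χ : DirichletCharacter R (p ^ (n + 1))) : χ.Odd ↔ χ u ^ m = -1 := by
    rw [DirichletCharacter.Odd, ← map_pow, ← Units.val_pow_eq_pow_val, hum, Units.val_neg,
      Units.val_one]
  rw [← finprod_mem_coe_finset]
  refine finprod_mem_eq_of_bijOn (s := {χ : DirichletCharacter R (p ^ (n + 1)) | χ.Odd})
    (fun χ : DirichletCharacter R (p ^ (n + 1)) ↦ χ u) ⟨?_, ?_, ?_⟩ ?_
  · intro χ hχ
    simpa [mem_nthRootsFinset hm0] using (hodd χ).mp hχ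
  · intro χ _ ψ _ h
    exact dirichletCharacter_ext_generator hu h
  · intro ξ hξ
    rw [mem_coe, mem_nthRootsFinset hm0] at hξ
    obtain ⟨χ, rfl⟩ := exists_dirichletCharacter_apply_eq hu (ξ := ξ)
      (by rw [hm, mul_comm, pow_mul, hξ, neg_one_sq]) (orderOf_pos u).ne'
    exact ⟨χ, (hodd χ).mpr hξ, rfl⟩
  · intro χ hχ
    rw [sum_conductor_eq_altSum hp hp2, altSum_eq_eval₂_altPoly hu]
    rintro rfl
    have := (hodd _).mp hχ
    rw [MulChar.one_apply u.isUnit, one_pow] at this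
    norm_num at this

theorem exists_int_eq_prod_nthRootsFinset {K : Type*} [Field K] [IsAlgClosed K] [CharZero K]
    (F : ℤ[X]) {m : ℕ} (hm : m ≠ 0) :
    ∃ z : ℤ, ∏ ξ ∈ nthRootsFinset m (-1 : K), F.eval₂ (Int.castRingHom K) ξ = z := by
  have h := resultant_eq_prod_eval (X ^ m + 1 : K[X]) (F.map (Int.castRingHom K)) F.natDegree
    natDegree_map_le (IsAlgClosed.splits _)
  have hmap : (X ^ m + 1 : ℤ[X]).map (Int.castRingHom K) = X ^ m + 1 := by simp
  have hmonic : (X ^ m + 1 : K[X]).leadingCoeff = 1 := monic_X_pow_add_C 1 hm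
  rw [← hmap, resultant_map_map, hmap, hmonic, one_pow, one_mul] at h
  refine ⟨_, Eq.trans ?_ h.symm⟩
  have hroots : (X ^ m + 1 : K[X]).roots = nthRoots m (-1 : K) := by
    rw [nthRoots]
    simp
  have hnodup : (nthRoots m (-1 : K)).Nodup :=
    nodup_roots (separable_X_pow_sub_C _ (by exact_mod_cast hm) (by simp))
  classical
  rw [hroots, nthRootsFinset_def, Finset.prod, Multiset.toFinset_val, hnodup.dedup]
  simp [eval₂_eq_eval_map]

theorem IsPrimitiveRoot.pow_eq_neg_one_of_two_mul {R : Type*} [CommRing R] [IsDomain R] {h : ℕ}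
    {θ : R} (hθ : IsPrimitiveRoot θ (2 * h)) (hh : h ≠ 0) : θ ^ h = -1 := by
  refine (eq_or_eq_neg_of_sq_eq_sq _ 1 ?_).resolve_left fun h2 ↦ ?_
  · rw [← pow_mul, mul_comm, hθ.pow_eq_one, one_pow]
  · exact absurd (Nat.le_of_dvd (by lia) (hθ.dvd_of_pow_eq_one _ h2)) (by lia)

theorem prod_nthRootsFinset_succ {K M : Type*} [Field K] [CharZero K] [CommMonoid M] {p h : ℕ}
    [hp : Fact p.Prime] (hph : p - 1 = 2 * h) (hh : h ≠ 0) {θ : K} (hθ : IsPrimitiveRoot θ (p - 1))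
    (n : ℕ) (F : K → M) :
    ∏ ξ ∈ nthRootsFinset (p ^ (n + 1) * h) (-1 : K), F ξ =
      (∏ ξ ∈ nthRootsFinset (p ^ n * h) (-1 : K), F ξ) *
        ∏ i ∈ range (p - 1) with Odd i, ∏ ζ ∈ primitiveRoots (p ^ (n + 1)) K, F (θ ^ i * ζ) := by
  classical
  have hp0 := hp.out.pos
  have hpodd : Odd p := ⟨h, by lia⟩
  have hpos (k : ℕ) : 0 < p ^ k * h := by positivity
  have hθh : θ ^ h = -1 := (hph ▸ hθ).pow_eq_neg_one_of_two_mul hh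
  have hθp (k : ℕ) : θ ^ p ^ k = θ := by
    induction k with
    | zero => simp
    | succ k ih =>
      rw [pow_succ, pow_mul, ih]
      conv_lhs => rw [show p = (p - 1) + 1 by lia, pow_succ, hθ.pow_eq_one, one_mul]
  have hθpow (i k : ℕ) : (θ ^ i) ^ (p ^ k * h) = (-1) ^ i := by
    rw [← pow_mul, mul_comm, mul_assoc, pow_mul, hθp, pow_mul, hθh]
  have hsub : nthRootsFinset (p ^ n * h) (-1 : K) ⊆ nthRootsFinset (p ^ (n + 1) * h) (-1 : K) := by
    intro ξ hξ
    rw [mem_nthRootsFinset (hpos _)] at hξ ⊢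
    rw [show p ^ (n + 1) * h = p ^ n * h * p by ring, pow_mul, hξ, hpodd.neg_one_pow]
  rw [← prod_sdiff hsub, mul_comm]
  congr 1
  rw [← prod_product']
  symm
  refine prod_nbij (fun x : ℕ × K ↦ θ ^ x.1 * x.2) ?_ ?_ ?_ (fun _ _ ↦ rfl)
  · rintro ⟨i, ζ⟩ hx
    rw [mem_product, mem_filter] at hx
    obtain ⟨⟨-, hi⟩, hζ⟩ := hx
    dsimp only at hi hζ ⊢
    have hζ' := isPrimitiveRoot_of_mem_primitiveRoots hζ
    rw [mem_sdiff, mem_nthRootsFinset (hpos _), mem_nthRootsFinset (hpos _), mul_pow, mul_pow,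
      hθpow, hθpow, hi.neg_one_pow, pow_mul, hζ'.pow_eq_one, one_pow, mul_one]
    refine ⟨rfl, fun h1 ↦ ?_⟩
    have h2 : ζ ^ (p ^ n * h) = 1 := by simpa using h1
    have h3 := hζ'.dvd_of_pow_eq_one _ h2
    rw [pow_succ] at h3
    have h4 := Nat.le_of_dvd (by lia) (Nat.dvd_of_mul_dvd_mul_left (by positivity) h3)
    lia
  · rintro ⟨i, ζ⟩ hx ⟨j, ξ⟩ hy hxy
    rw [mem_coe, mem_product, mem_filter] at hx hy
    obtain ⟨⟨hi, -⟩, hζ⟩ := hx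
    obtain ⟨⟨hj, -⟩, hξ⟩ := hy
    dsimp only at *
    have h1 := congr($hxy ^ p ^ (n + 1))
    rw [mul_pow, mul_pow, (isPrimitiveRoot_of_mem_primitiveRoots hζ).pow_eq_one,
      (isPrimitiveRoot_of_mem_primitiveRoots hξ).pow_eq_one, pow_right_comm, hθp, pow_right_comm,
      hθp, mul_one, mul_one] at h1
    obtain rfl := hθ.pow_inj (mem_range.mp hi) (mem_range.mp hj) h1
    have hθ0 : θ ^ i ≠ 0 := pow_ne_zero _ (hθ.ne_zero (by lia))
    rw [mul_left_cancel₀ hθ0 hxy]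
  · intro ξ hξ
    rw [mem_coe, mem_sdiff, mem_nthRootsFinset (hpos _), mem_nthRootsFinset (hpos _)] at hξ
    obtain ⟨hξ1, hξ2⟩ := hξ
    have : NeZero (p - 1) := ⟨by lia⟩
    obtain ⟨i, hi, hiξ⟩ := hθ.eq_pow_of_pow_eq_one (ξ := ξ ^ p ^ (n + 1)) (by
      rw [hph, ← pow_mul, show p ^ (n + 1) * (2 * h) = p ^ (n + 1) * h * 2 by ring, pow_mul, hξ1,
        neg_one_sq])
    have hiodd : (-1 : K) ^ i = -1 := by
      rw [← hθpow i 0, hiξ, ← pow_mul, pow_zero, one_mul, hξ1]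
    have hθ0 : θ ^ i ≠ 0 := pow_ne_zero _ (hθ.ne_zero (by lia))
    have hi' : Odd i := by
      rw [← Nat.not_even_iff_odd]
      intro h1
      rw [h1.neg_one_pow] at hiodd
      norm_num at hiodd
    refine ⟨(i, ξ / θ ^ i), ?_, mul_div_cancel₀ _ hθ0⟩
    rw [mem_coe, mem_product, mem_filter, mem_range, mem_primitiveRoots (by positivity)]
    refine ⟨⟨hi, hi'⟩, ?_⟩
    rw [IsPrimitiveRoot.iff_orderOf]
    refine orderOf_eq_prime_pow (fun h1 ↦ hξ2 ?_) ?_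
    · rw [div_pow, div_eq_one_iff_eq (pow_ne_zero _ hθ0)] at h1
      rw [pow_mul, h1, ← pow_mul, hθpow, hiodd]
    · rw [div_pow, ← hiξ, pow_right_comm, hθp, div_self hθ0]

theorem exists_prod_primitiveRoots_norm_eval₂_eq {p : ℕ} [hp : Fact p.Prime] {K : Type*}
    [NormedField K] [IsUltrametricDist K] {f : ℤ_[p] →+* K} (hf : ∀ x, ‖f x‖ = ‖x‖)
    (hK : ∀ k, (primitiveRoots (p ^ (k + 1)) K).Nonempty) {F : ℕ → ℤ[X]}
    (hF : ∀ n, X ^ (p ^ n * (p - 1)) - 1 ∣ F (n + 1) - F n) {η : ℤ_[p]} (hη : η ^ (p - 1) = 1)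
    (h0 : (F 0).eval₂ (Int.castRingHom K) (f η) ≠ 0) :
    ∃ μ lam N : ℕ, ∀ n, N ≤ n →
      ∏ ζ ∈ primitiveRoots (p ^ (n + 1)) K, ‖(F (n + 1)).eval₂ (Int.castRingHom K) (f η * ζ)‖ =
        ((p : ℝ)⁻¹) ^ (μ * (p ^ n * (p - 1)) + lam) := by
  have heval (P : ℤ[X]) (ζ : K) : (P.eval₂ (Int.castRingHom ℤ_[p][X]) (C η * X)).eval₂ f ζ =
      P.eval₂ (Int.castRingHom K) (f η * ζ) := by
    rw [← coe_eval₂RingHom, hom_eval₂]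
    congr 1
    · exact RingHom.ext_int _ _
    · simp
  have hcoh (n : ℕ) : X ^ p ^ n - 1 ∣ (F (n + 1)).eval₂ (Int.castRingHom ℤ_[p][X]) (C η * X) -
      (F n).eval₂ (Int.castRingHom ℤ_[p][X]) (C η * X) := by
    obtain ⟨Q, hQ⟩ := hF n
    have h := congrArg (eval₂ (Int.castRingHom ℤ_[p][X]) (C η * X)) hQ
    rw [eval₂_sub, eval₂_mul, eval₂_sub, eval₂_X_pow, eval₂_one, mul_pow, ← C_pow, mul_comm (p ^ n),
      pow_mul η, hη, one_pow, C_1, one_mul, mul_comm (p - 1)] at h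
    rw [h]
    refine Dvd.dvd.mul_right ?_ _
    rw [pow_mul]
    exact sub_one_dvd_pow_sub_one _ _
  have hne : ¬ X ^ p ^ 0 - 1 ∣ (F 0).eval₂ (Int.castRingHom ℤ_[p][X]) (C η * X) := by
    intro h
    apply h0
    obtain ⟨Q, hQ⟩ := h
    have h := congrArg (eval₂ f 1) hQ
    rw [heval, mul_one, eval₂_mul, eval₂_sub, eval₂_X_pow, eval₂_one, one_pow, sub_self,
      zero_mul] at h
    exact h
  obtain ⟨μ, lam, N, hN⟩ := exists_iwasawa_invariants hcoh ⟨0, hne⟩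
  refine ⟨μ, lam, N + lam, fun n hn ↦ ?_⟩
  obtain ⟨H, ⟨Q, hQ⟩, h1, h2⟩ := hN (n + 1) (by lia)
  have htot := Nat.totient_prime_pow_succ hp.out n
  have hlam : lam < (p ^ (n + 1)).totient := calc
    lam ≤ n := by lia
    _ < p ^ n := Nat.lt_pow_self hp.out.one_lt
    _ ≤ _ := by rw [htot]; exact Nat.le_mul_of_pos_right _ (Nat.sub_pos_of_lt hp.out.one_lt)
  rw [← htot, ← prod_primitiveRoots_norm_eval₂ hf (hK n) h1 h2 hlam]
  refine prod_congr rfl fun ζ hζ ↦ ?_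
  have h := congrArg (eval₂ f ζ) hQ
  rw [eval₂_sub, heval, eval₂_mul f ζ (p := X ^ _ - 1), eval₂_sub, eval₂_X_pow, eval₂_one,
    (isPrimitiveRoot_of_mem_primitiveRoots hζ).pow_eq_one, sub_self, zero_mul, sub_eq_zero] at h
  rw [h]

theorem eq_add_mul_pow_of_succ_eq {v : ℕ → ℝ} {p N : ℕ} {μ lam : ℝ}
    (hv : ∀ n, N ≤ n → v (n + 1) = v n + (μ * ((p : ℝ) ^ n * (p - 1)) + lam)) (n : ℕ) (hn : N ≤ n) :
    v n = μ * (p : ℝ) ^ n + lam * n + (v N - μ * (p : ℝ) ^ N - lam * N) := by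
  induction n, hn using Nat.le_induction with
  | base => ring
  | succ n hn ih =>
    rw [hv n hn, ih]
    push_cast
    ring

theorem exists_formula_of_padic_norm {p : ℕ} [hp : Fact p.Prime] {K : Type*} [NormedField K]
    {f : ℤ_[p] →+* K} (hf : ∀ x, ‖f x‖ = ‖x‖) {P : ℕ → K} (hP0 : ∀ n, P n ≠ 0)
    (hPint : ∀ n, ∃ z : ℤ, P n = z) {μ lam N : ℕ}
    (hP : ∀ n, N ≤ n → ‖P (n + 1)‖ = ‖P n‖ * ((p : ℝ)⁻¹) ^ (μ * (p ^ n * (p - 1)) + lam)) :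
    ∃ C : ℚ, ∀ n, N ≤ n → -Real.log ‖P n‖ / Real.log p = (μ : ℝ) * (p : ℝ) ^ n + lam * n + C := by
  have hlog : Real.log p ≠ 0 := (Real.log_pos (by exact_mod_cast hp.out.one_lt)).ne'
  obtain ⟨z, hz⟩ := hPint N
  have hz' : -Real.log ‖P N‖ / Real.log p = ((z : ℤ_[p]).valuation : ℝ) := by
    have hz0 : (z : ℤ_[p]) ≠ 0 := by
      rintro h
      exact hP0 N (by rw [hz, ← map_intCast f, h, map_zero])
    rw [hz, ← map_intCast f, hf, PadicInt.norm_eq_zpow_neg_valuation hz0, Real.log_zpow]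
    push_cast
    field_simp
  refine ⟨(z : ℤ_[p]).valuation - μ * (p : ℚ) ^ N - lam * N, fun n hn ↦ ?_⟩
  push_cast
  rw [← hz']
  refine eq_add_mul_pow_of_succ_eq (v := fun n ↦ -Real.log ‖P n‖ / Real.log p) (fun n hn ↦ ?_) n hn
  rw [hP n hn, Real.log_mul (norm_ne_zero_iff.mpr (hP0 n)) (by
    have := hp.out.ne_zero
    positivity), Real.log_pow, Real.log_inv]
  push_cast [Nat.cast_sub hp.out.one_le]
  field_simp
  ring

/-- Let `p` be an odd prime and work in `ℂ_p`, modelled as a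
complete, algebraically closed, nonarchimedean normed field `K` whose norm
extends the `p`-adic norm of `ℚ_p`; write `ord_p x = −log‖x‖/log p`. Then
there exist `m ∈ ℚ`, `λ ∈ ℕ`, `c ∈ ℚ` and `n₀ ∈ ℕ` such that for all `n ≥ n₀`,
`ord_p (∏_χ ∑_{a=1}^{f_χ} (−1)^a χ⁰(a)) = m·p^n + λ·n + c`, where the product
runs over all odd primitive Dirichlet characters with conductor dividing
`p^{n+1}`; these are exactly the primitive characters `χ⁰ = χ.primitiveCharacter`
(of conductor `f_χ = χ.conductor`) attached to the odd Dirichlet characters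
`χ` modulo `p^{n+1}`. -/
theorem statement16 (p : ℕ) [Fact p.Prime] (hp2 : p ≠ 2)
    (K : Type*) [NontriviallyNormedField K] [IsAlgClosed K] [CompleteSpace K]
    [IsUltrametricDist K] [Algebra ℚ_[p] K]
    (hnorm : ∀ x : ℚ_[p], ‖algebraMap ℚ_[p] K x‖ = ‖x‖) :
    ∃ (m : ℚ) (lam : ℕ) (C : ℚ) (n₀ : ℕ), ∀ n : ℕ, n₀ ≤ n →
      -Real.log ‖∏ᶠ (χ : DirichletCharacter K (p ^ (n + 1))) (_ : χ.Odd),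
          ∑ a ∈ Finset.Icc 1 χ.conductor,
            (-1 : K) ^ a * χ.primitiveCharacter ((a : ℕ) : ZMod χ.conductor)‖ /
          Real.log p =
        (m : ℝ) * (p : ℝ) ^ n + (lam : ℝ) * n + (C : ℝ) := by
  have hp : p.Prime := Fact.out
  have : CharZero K := charZero_of_injective_algebraMap (algebraMap ℚ_[p] K).injective
  let f : ℤ_[p] →+* K := (algebraMap ℚ_[p] K).comp PadicInt.Coe.ringHom
  have hf (x : ℤ_[p]) : ‖f x‖ = ‖x‖ := hnorm x
  have hfinj : Function.Injective f := (algebraMap ℚ_[p] K).injective.comp Subtype.val_injective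
  have hpodd : Odd p := hp.odd_of_ne_two hp2
  obtain ⟨h, hph⟩ : ∃ h, p - 1 = 2 * h := ⟨p / 2, by have := hpodd; grind⟩
  have hh : h ≠ 0 := by have := hp.two_le; lia
  obtain ⟨η, hη, hη'⟩ := PadicInt.exists_pow_eq_one_and_dvd p
  have hθ : IsPrimitiveRoot (f η) (p - 1) := by
    refine ⟨by rw [← map_pow, hη, map_one], fun k hk ↦ hη' k ?_⟩
    rw [← map_pow, ← map_one f] at hk
    rw [hfinj hk, sub_self, norm_zero]
    exact one_pos
  obtain ⟨g, hg⟩ := exists_unit_orderOf_unitMod hp2 hη hη'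
  have hgm (n : ℕ) : orderOf (unitMod g n) = 2 * (p ^ n * h) := by rw [hg, hph]; ring
  have hgen (n : ℕ) := mem_zpowers_unitMod (hg n)
  have hdvd (n : ℕ) :
      X ^ (p ^ n * (p - 1)) - 1 ∣ altPoly (unitMod g (n + 1)) - altPoly (unitMod g n) := by
    rw [← hg]
    refine X_pow_sub_one_dvd_altPoly_sub (pow_dvd_pow p n.succ.le_succ) hpodd.pow
      (fun a ha ↦ ?_) (hgen _) (hgen _) (unitsMap_unitMod g n)
    rw [Nat.coprime_pow_right_iff (by lia)] at ha ⊢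
    exact ha
  let P (n : ℕ) : K := ∏ ξ ∈ nthRootsFinset (p ^ n * h) (-1 : K),
    (altPoly (unitMod g n)).eval₂ (Int.castRingHom K) ξ
  have hPpos (n : ℕ) : 0 < p ^ n * h := Nat.mul_pos (pow_pos hp.pos n) (Nat.pos_of_ne_zero hh)
  have hPint (n : ℕ) : ∃ z : ℤ, P n = z :=
    exists_int_eq_prod_nthRootsFinset _ (hPpos n).ne'
  have hPsucc (n : ℕ) : P (n + 1) = P n * ∏ i ∈ range (p - 1) with Odd i,
      ∏ ζ ∈ primitiveRoots (p ^ (n + 1)) K,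
        (altPoly (unitMod g (n + 1))).eval₂ (Int.castRingHom K) (f η ^ i * ζ) := by
    refine (prod_nthRootsFinset_succ hph hh hθ n _).trans ?_
    congr 1
    refine prod_congr rfl fun ξ hξ ↦ ?_
    rw [mem_nthRootsFinset (hPpos n)] at hξ
    obtain ⟨Q, hQ⟩ := hdvd n
    have h1 := congrArg (eval₂ (Int.castRingHom K) ξ) hQ
    rw [eval₂_sub, eval₂_mul, eval₂_sub, eval₂_X_pow, eval₂_one, hph,
      show p ^ n * (2 * h) = p ^ n * h * 2 by ring, pow_mul, hξ, neg_one_sq, sub_self, zero_mul,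
      sub_eq_zero] at h1
    exact h1
  simp only [fun n ↦ finprod_odd_eq_prod_nthRootsFinset (R := K) hp hp2 (hgen n) (hgm n)]
  by_cases hP0 : ∀ n, P n ≠ 0
  · have hK (k : ℕ) : (primitiveRoots (p ^ (k + 1)) K).Nonempty := by
      have : NeZero ((p ^ (k + 1) : ℕ) : K) := ⟨by exact_mod_cast pow_ne_zero _ hp.ne_zero⟩
      obtain ⟨ζ, hζ⟩ := HasEnoughRootsOfUnity.exists_primitiveRoot K (p ^ (k + 1))
      exact ⟨ζ, (mem_primitiveRoots (pow_pos hp.pos _)).mpr hζ⟩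
    have key (i : ℕ) : ∃ μ lam N : ℕ, Odd i → ∀ n, N ≤ n →
        ∏ ζ ∈ primitiveRoots (p ^ (n + 1)) K,
          ‖(altPoly (unitMod g (n + 1))).eval₂ (Int.castRingHom K) (f η ^ i * ζ)‖ =
        ((p : ℝ)⁻¹) ^ (μ * (p ^ n * (p - 1)) + lam) := by
      by_cases hi : Odd i
      · have h0 : (altPoly (unitMod g 0)).eval₂ (Int.castRingHom K) (f (η ^ i)) ≠ 0 := by
          refine prod_ne_zero_iff.mp (hP0 0) _ ?_
          have hθh : f η ^ h = -1 := (hph ▸ hθ).pow_eq_neg_one_of_two_mul hh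
          rw [mem_nthRootsFinset (hPpos 0), pow_zero, one_mul, map_pow, pow_right_comm, hθh,
            hi.neg_one_pow]
        obtain ⟨μ, lam, N, H⟩ := exists_prod_primitiveRoots_norm_eval₂_eq hf hK
          (F := fun n ↦ altPoly (unitMod g n)) hdvd (η := η ^ i)
          (by rw [pow_right_comm, hη, one_pow]) h0
        exact ⟨μ, lam, N, fun _ n hn ↦ by simpa only [map_pow] using H n hn⟩
      · exact ⟨0, 0, 0, fun h1 ↦ absurd h1 hi⟩
    choose μ lam N H using key
    let S := {i ∈ range (p - 1) | Odd i}
    obtain ⟨C, hC⟩ := exists_formula_of_padic_norm hf hP0 hPint (μ := ∑ i ∈ S, μ i)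
      (lam := ∑ i ∈ S, lam i) (N := S.sup N) fun n hn ↦ by
        rw [hPsucc, norm_mul, norm_prod S, sum_mul, ← sum_add_distrib, ← prod_pow_eq_pow_sum]
        refine congrArg _ (prod_congr rfl fun i hi ↦ ?_)
        rw [norm_prod, H i (mem_filter.mp hi).2 n ((le_sup hi).trans hn)]
    exact ⟨(∑ i ∈ S, μ i : ℕ), _, C, _, fun n hn ↦ (hC n hn).trans (by rw [Rat.cast_natCast])⟩
  · push Not at hP0
    obtain ⟨n₁, hn₁⟩ := hP0
    refine ⟨0, 0, 0, n₁, fun n hn ↦ ?_⟩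
    have h0 : P n = 0 := by
      induction n, hn using Nat.le_induction with
      | base => exact hn₁
      | succ n _ ih => rw [hPsucc, ih, zero_mul]
    change -Real.log ‖P n‖ / _ = _
    simp [h0]
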